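/- Suppose the system is highly non-singular and s > 2s_0, where s_0 = Σ_{h=1}^{t} (μ_h − μ_{h+1}) u_h for some positive integers u_h satisfying u_h > (k/2) ϖ_h for 1 ≤ h ≤ t. Then the limit 𝔍 = lim_{X→∞} 𝔍(X) exists, and there are ν > 0 and a constant C, independent of P, such that |𝔍 − 𝔍(X)| ≤ C P^{s−K} X^{−ν} for all P ≥ 1 and all X ≥ 1. -/

import Mathlib

open MeasureTheory Filter Finset
open scoped Classical

noncomputable section

/-- `e(θ) = exp(2πiθ)`. -/
def eC (θ : ℝ) : ℂ := Complex.exp (2 * Real.pi * Complex.I * θ)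

/-- Index pairs `(l, n)` for the distinct exponents `k_{l,n}`. -/
abbrev KIdx (t : ℕ) (ν : Fin t → ℕ) := Σ l : Fin t, Fin (ν l)

/-- Equation indices `(l, n, m)`: the `μ_l` equations of exponent `k_{l,n}`
(the interval `𝓘_{l,n}`). -/
abbrev EqIdx (t : ℕ) (ν μ : Fin t → ℕ) := Σ l : Fin t, Fin (ν l) × Fin (μ l)

variable (t : ℕ) (ν μ : Fin t → ℕ) (k : (l : Fin t) → Fin (ν l) → ℕ)

/-- The degree `d_i` of equation `i`. -/
def deg (i : EqIdx t ν μ) : ℕ := k i.1 i.2.1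

/-- `μ_h` for `1 ≤ h ≤ t` (`1`-based), with the convention `μ_{t+1} = 0`. -/
def mu1 (h : ℕ) : ℕ := if hh : 1 ≤ h ∧ h ≤ t then μ ⟨h - 1, by omega⟩ else 0

/-- `ϖ_h = ν(1) + ⋯ + ν(h)`. -/
def varpi (h : ℕ) : ℕ := ∑ l : Fin t, if (l : ℕ) < h then ν l else 0

/-- `K_1 + ⋯ + K_h`. -/
def Ksum (h : ℕ) : ℕ := ∑ p : KIdx t ν, if (p.1 : ℕ) < h then k p.1 p.2 else 0

/-- The largest degree `k`. -/
def kmax : ℕ := Finset.univ.sup fun p : KIdx t ν => k p.1 p.2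

/-- The total degree `K = d_1 + ⋯ + d_r`. -/
def Ktot : ℕ := ∑ i : EqIdx t ν μ, deg t ν μ k i

/-- The grouping hypotheses: `t ≥ 1`, all `ν l ≥ 1`, the multiplicities are
positive and strictly decreasing `μ_1 > ⋯ > μ_t`, and the exponents `k_{l,n}`
are positive and pairwise distinct. -/
def GroupedDegrees : Prop :=
  0 < t ∧ (∀ l, 0 < ν l) ∧ (∀ l, 0 < μ l) ∧ StrictAnti μ ∧
    (∀ l n, 0 < k l n) ∧ Function.Injective fun p : KIdx t ν => k p.1 p.2

/-- `ℤ ∩ [1, P]` as a finite set. -/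
def completeFS (P : ℝ) : Finset ℕ := Finset.Icc 1 ⌊P⌋₊

/-- `𝒜(P,R)`: the `R`-smooth numbers up to `P`. -/
def smoothFS (P R : ℝ) : Finset ℕ :=
  (Finset.Icc 1 ⌊P⌋₊).filter fun n => ∀ p : ℕ, p.Prime → p ∣ n → (p : ℝ) ≤ R

/-- The exponential sum `f_{𝐤_h}(γ; 𝒜) = Σ_{x ∈ 𝒜} e(Σ_{l ≤ h, n} γ_{l,n} x^{k_{l,n}})`. -/
def fA (A : Finset ℕ) (h : ℕ) (γ : KIdx t ν → ℝ) : ℂ :=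
  ∑ x ∈ A, eC (∑ p : KIdx t ν, if (p.1 : ℕ) < h then γ p * (x : ℝ) ^ (k p.1 p.2) else 0)

/-- The mean value `J_{u,𝐤_h}(𝒜)` (the coordinates `γ_{l,n}` with `l > h` are
dummy variables over the probability box, so this agrees with the
`ϖ_h`-dimensional integral). -/
def JA (A : Finset ℕ) (u h : ℕ) : ℝ :=
  ∫ γ in Set.univ.pi fun _ : KIdx t ν => Set.Ico (0 : ℝ) 1, ‖fA t ν k A h γ‖ ^ (2 * u)

variable (s : ℕ) (c : EqIdx t ν μ → Fin s → ℤ)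

/-- The system `Σ_j c_{ij} x_j^{d_i} = 0` is highly non-singular: all coefficients
are nonzero and every `μ_l × μ_l` minor taken from the rows `𝓘_{l,n}` is nonzero. -/
def HighlyNonSingular : Prop :=
  (∀ i j, c i j ≠ 0) ∧
  ∀ (l : Fin t) (n : Fin (ν l)) (J : Fin (μ l) → Fin s), Function.Injective J →
    (Matrix.of fun m m' : Fin (μ l) => c ⟨l, (n, m)⟩ (J m')).det ≠ 0

/-- `x` is a solution of the system, with coordinates in a commutative ring. -/
def IsSol {A : Type*} [CommRing A] (x : Fin s → A) : Prop :=
  ∀ i, ∑ j, (c i j : A) * x j ^ deg t ν μ k i = 0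

/-- The Jacobian `(d_i c_{ij} x_j^{d_i - 1})` has full rank `r` at `x`. -/
def JacFullRank {A : Type*} [CommRing A] (x : Fin s → A) : Prop :=
  (Matrix.of fun (i : EqIdx t ν μ) (j : Fin s) =>
      (deg t ν μ k i : A) * (c i j : A) * x j ^ (deg t ν μ k i - 1)).rank
    = Fintype.card (EqIdx t ν μ)

/-- The generalized exponential sum `f_j(α; 𝒜) = Σ_{x ∈ 𝒜} e(Σ_{l,n} γ_{j,l,n} x^{k_{l,n}})`,
where `γ_{j,l,n} = Σ_{i ∈ 𝓘_{l,n}} c_{ij} α_i`. -/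
def fj (A : Finset ℕ) (α : EqIdx t ν μ → ℝ) (j : Fin s) : ℂ :=
  ∑ x ∈ A, eC (∑ i : EqIdx t ν μ, (c i j : ℝ) * α i * (x : ℝ) ^ deg t ν μ k i)

end

noncomputable section

/-- `v_j(β; P) = ∫_0^P e(Σ_{l,n} δ_{j,l,n} z^{k_{l,n}}) dz` with
`δ_{j,l,n} = Σ_{i ∈ 𝓘_{l,n}} c_{ij} β_i`. -/
def vj (t : ℕ) (ν μ : Fin t → ℕ) (k : (l : Fin t) → Fin (ν l) → ℕ) (s : ℕ)
    (c : EqIdx t ν μ → Fin s → ℤ) (P : ℝ) (β : EqIdx t ν μ → ℝ) (j : Fin s) : ℂ :=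
  ∫ z in (0:ℝ)..P, eC (∑ i : EqIdx t ν μ, (c i j : ℝ) * β i * z ^ deg t ν μ k i)

/-- The truncated singular integral `𝔍(X) = ∫_{𝓘(P,X)} Π_j v_j(β;P) dβ`, where
`𝓘(P,X)` is the box `|β_i| ≤ X P^{-d_i}`. -/
def singInt (t : ℕ) (ν μ : Fin t → ℕ) (k : (l : Fin t) → Fin (ν l) → ℕ) (s : ℕ)
    (c : EqIdx t ν μ → Fin s → ℤ) (P X : ℝ) : ℂ :=
  ∫ β in Set.univ.pi fun i : EqIdx t ν μ =>
      Set.Icc (-(X * P ^ (-(deg t ν μ k i : ℝ)))) (X * P ^ (-(deg t ν μ k i : ℝ))),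
    ∏ j : Fin s, vj t ν μ k s c P β j

lemma norm_eC (θ : ℝ) : ‖eC θ‖ = 1 := by
  rw [eC, show (2 * Real.pi * Complex.I * θ : ℂ) = ((2 * Real.pi * θ : ℝ) : ℂ) * Complex.I by
    push_cast; ring]
  exact Complex.norm_exp_ofReal_mul_I _

lemma continuous_eC : Continuous eC := by
  unfold eC; fun_prop

lemma eC_neg (θ : ℝ) : eC (-θ) = starRingEnd ℂ (eC θ) := by
  rw [eC, eC, ← Complex.exp_conj]
  simp [map_ofNat]

lemma hasDerivAt_eC_eval (p : Polynomial ℝ) (x : ℝ) :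
    HasDerivAt (fun z => eC (p.eval z))
      (2 * Real.pi * Complex.I * (p.derivative.eval x : ℝ) * eC (p.eval x)) x := by
  have h1 : HasDerivAt (fun z : ℝ => (2 * Real.pi * Complex.I * (p.eval z : ℝ) : ℂ))
      (2 * Real.pi * Complex.I * (p.derivative.eval x : ℝ)) x :=
    ((p.hasDerivAt x).ofReal_comp).const_mul _
  have h2 := h1.cexp
  unfold eC
  convert h2 using 1
  ring

lemma norm_integral_eC_le_abs_sub (f : ℝ → ℝ) (a b : ℝ) :
    ‖∫ x in a..b, eC (f x)‖ ≤ |b - a| := by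
  simpa using intervalIntegral.norm_integral_le_of_norm_le_const (a := a) (b := b)
    (C := 1) (f := fun x => eC (f x)) (fun x _ => (norm_eC _).le)

lemma norm_integral_eC_neg (p : Polynomial ℝ) (a b : ℝ) :
    ‖∫ x in a..b, eC ((-p).eval x)‖ = ‖∫ x in a..b, eC (p.eval x)‖ := by
  simp only [Polynomial.eval_neg, eC_neg]
  rw [intervalIntegral.intervalIntegral_conj]
  simp

/-- First derivative test: integration by parts. -/
lemma norm_integral_eC_le_of_le_derivative (p : Polynomial ℝ) {a b l V : ℝ} (hab : a ≤ b)
    (hl : 0 < l) (h : ∀ x ∈ Set.Icc a b, l ≤ p.derivative.eval x)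
    (hV : ∫ x in a..b, |p.derivative.derivative.eval x| / p.derivative.eval x ^ 2 ≤ V) :
    ‖∫ x in a..b, eC (p.eval x)‖ ≤ 2 / l + V := by
  set q := p.derivative with hq
  have hne : ∀ x ∈ Set.uIcc a b, q.eval x ≠ 0 := fun x hx =>
    (hl.trans_le (h x (by rwa [Set.uIcc_of_le hab] at hx))).ne'
  have hneC : ∀ x ∈ Set.uIcc a b, ((q.eval x : ℝ) : ℂ) ≠ 0 := fun x hx =>
    Complex.ofReal_ne_zero.2 (hne x hx)
  have hpi : (2 * Real.pi * Complex.I : ℂ) ≠ 0 := by simp [Real.pi_ne_zero]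
  have hcE : Continuous fun x => eC (p.eval x) := continuous_eC.comp p.continuous
  have hcq : Continuous fun x => ((q.eval x : ℝ) : ℂ) := by fun_prop
  have hcq' : Continuous fun x => ((q.derivative.eval x : ℝ) : ℂ) := by fun_prop
  set g : ℝ → ℂ := fun x =>
    eC (p.eval x) * (q.derivative.eval x : ℝ) / (2 * Real.pi * Complex.I * (q.eval x : ℝ) ^ 2)
  have hg : IntervalIntegrable g volume a b := by
    apply ContinuousOn.intervalIntegrable
    refine ContinuousOn.div (hcE.mul hcq').continuousOn
      (continuous_const.mul (hcq.pow 2)).continuousOn fun x hx => ?_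
    exact mul_ne_zero hpi (pow_ne_zero 2 (hneC x hx))
  have hE : IntervalIntegrable (fun x => eC (p.eval x)) volume a b := hcE.intervalIntegrable _ _
  have hd : ∀ x ∈ Set.uIcc a b,
      HasDerivAt (fun x => eC (p.eval x) / (2 * Real.pi * Complex.I * (q.eval x : ℝ)))
        (eC (p.eval x) - g x) x := by
    intro x hx
    have h1 : HasDerivAt (fun z : ℝ => (2 * Real.pi * Complex.I * (q.eval z : ℝ) : ℂ))
        (2 * Real.pi * Complex.I * (q.derivative.eval x : ℝ)) x :=
      ((q.hasDerivAt x).ofReal_comp).const_mul _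
    have h2 := (hasDerivAt_eC_eval p x).div h1 (mul_ne_zero hpi (hneC x hx))
    refine h2.congr_deriv ?_
    have := hneC x hx
    simp only [g]
    have hp : (Real.pi : ℂ) ≠ 0 := by simp [Real.pi_ne_zero]
    field_simp
    rw [← hq]
    ring
  have hI := intervalIntegral.integral_eq_sub_of_hasDerivAt hd (hE.sub hg)
  rw [intervalIntegral.integral_sub hE hg, sub_eq_iff_eq_add] at hI
  rw [hI]
  have hpi1 : (1 : ℝ) ≤ 2 * Real.pi := by linarith [Real.pi_gt_three]
  have hb : ∀ x ∈ Set.Icc a b,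
      ‖eC (p.eval x) / (2 * Real.pi * Complex.I * (q.eval x : ℝ))‖ ≤ 1 / l := by
    intro x hx
    have hx' := h x hx
    have hqx : |q.eval x| = q.eval x := abs_of_pos (hl.trans_le hx')
    rw [norm_div, norm_eC]
    simp only [norm_mul, Complex.norm_real, Complex.norm_I, Complex.norm_two, Real.norm_eq_abs,
      abs_of_pos Real.pi_pos, hqx]
    gcongr
    nlinarith
  have hgn : ‖∫ x in a..b, g x‖ ≤ V := by
    refine le_trans ?_ hV
    have hc : ContinuousOn (fun x => |q.derivative.eval x| / q.eval x ^ 2) (Set.uIcc a b) :=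
      ContinuousOn.div (by fun_prop) (by fun_prop) fun x hx => pow_ne_zero 2 (hne x hx)
    refine intervalIntegral.norm_integral_le_of_norm_le hab
      (Filter.Eventually.of_forall fun x hx => ?_) hc.intervalIntegrable
    simp only [g, norm_div, norm_mul, norm_eC, Complex.norm_real, Complex.norm_I, Complex.norm_two,
      Real.norm_eq_abs, abs_of_pos Real.pi_pos, norm_pow, sq_abs, one_mul, mul_one]
    have : 0 < q.eval x ^ 2 := by
      have := hl.trans_le (h x ⟨hx.1.le, hx.2⟩)
      positivity
    gcongr
    nlinarith
  refine (norm_add_le _ _).trans (add_le_add ((norm_sub_le _ _).trans ?_) hgn)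
  have := hb a ⟨le_rfl, hab⟩
  have := hb b ⟨hab, le_rfl⟩
  have e : 2 / l = 1 / l + 1 / l := by ring
  linarith

/-- First derivative test with monotone derivative. -/
lemma norm_integral_eC_le_of_monotone_derivative (p : Polynomial ℝ) {a b l : ℝ} (hab : a ≤ b)
    (hl : 0 < l) (h : ∀ x ∈ Set.Icc a b, l ≤ p.derivative.eval x)
    (hm : (∀ x ∈ Set.Icc a b, 0 ≤ p.derivative.derivative.eval x) ∨
      ∀ x ∈ Set.Icc a b, p.derivative.derivative.eval x ≤ 0) :
    ‖∫ x in a..b, eC (p.eval x)‖ ≤ 3 / l := by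
  set q := p.derivative with hq
  have hpos : ∀ x ∈ Set.Icc a b, 0 < q.eval x := fun x hx => hl.trans_le (h x hx)
  have hI : ∫ x in a..b, q.derivative.eval x / q.eval x ^ 2 = 1 / q.eval a - 1 / q.eval b := by
    rw [intervalIntegral.integral_eq_sub_of_hasDerivAt (f := fun x => -(q.eval x)⁻¹)]
    · simp; ring
    · intro x hx
      rw [Set.uIcc_of_le hab] at hx
      convert ((q.hasDerivAt x).fun_inv (hpos x hx).ne').fun_neg using 1
      ring
    · refine (ContinuousOn.div (by fun_prop) (by fun_prop) fun x hx => ?_).intervalIntegrable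
      rw [Set.uIcc_of_le hab] at hx
      exact pow_ne_zero 2 (hpos x hx).ne'
  have hb : ∀ x ∈ Set.Icc a b, 0 ≤ 1 / q.eval x ∧ 1 / q.eval x ≤ 1 / l := fun x hx =>
    ⟨by have := hpos x hx; positivity, one_div_le_one_div_of_le hl (h x hx)⟩
  have ha := hb a ⟨le_rfl, hab⟩
  have hb := hb b ⟨hab, le_rfl⟩
  have hV : ∫ x in a..b, |q.derivative.eval x| / q.eval x ^ 2 ≤ 1 / l := by
    rcases hm with hm | hm
    · rw [intervalIntegral.integral_congr (g := fun x => q.derivative.eval x / q.eval x ^ 2), hI]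
      · linarith
      · intro x hx
        rw [Set.uIcc_of_le hab] at hx
        simp only [abs_of_nonneg (hm x hx)]
    · rw [intervalIntegral.integral_congr (g := fun x => -(q.derivative.eval x / q.eval x ^ 2)),
        intervalIntegral.integral_neg, hI]
      · linarith
      · intro x hx
        rw [Set.uIcc_of_le hab] at hx
        simp only [abs_of_nonpos (hm x hx), neg_div]
  refine (norm_integral_eC_le_of_le_derivative p hab hl h hV).trans (le_of_eq ?_)
  ring

/-- Van der Corput's lemma for polynomial phases, with the lower bound for the `m`-th derivative
written as `d ^ (-m)`. -/
lemma exists_norm_integral_eC_le (m : ℕ) : ∃ C : ℝ, 0 ≤ C ∧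
    ∀ (p : Polynomial ℝ) (a b d : ℝ), a ≤ b → 0 < d →
      (∀ x ∈ Set.Icc a b, (d ^ (m + 1))⁻¹ ≤ (Polynomial.derivative^[m + 1] p).eval x) →
      (m = 0 → (∀ x ∈ Set.Icc a b, 0 ≤ p.derivative.derivative.eval x) ∨
        ∀ x ∈ Set.Icc a b, p.derivative.derivative.eval x ≤ 0) →
      ‖∫ x in a..b, eC (p.eval x)‖ ≤ C * d := by
  induction m with
  | zero =>
    refine ⟨3, by norm_num, fun p a b d hab hd h hm => ?_⟩
    refine (norm_integral_eC_le_of_monotone_derivative p hab (l := d⁻¹) (by positivity)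
      (by simpa using h) (hm rfl)).trans (le_of_eq ?_)
    field_simp
  | succ m ih =>
    obtain ⟨C, hC, ih⟩ := ih
    refine ⟨2 * C + 2, by positivity, fun p a b d hab hd h _ => ?_⟩
    set q := Polynomial.derivative^[m + 1] p with hq
    have hq' : ∀ x ∈ Set.Icc a b, (d ^ (m + 1 + 1))⁻¹ ≤ q.derivative.eval x := by
      intro x hx
      rw [hq, ← Function.iterate_succ_apply' (f := Polynomial.derivative)]
      exact h x hx
    have hgrow : ∀ x ∈ Set.Icc a b, ∀ y ∈ Set.Icc a b, x ≤ y →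
        (d ^ (m + 1 + 1))⁻¹ * (y - x) ≤ q.eval y - q.eval x :=
      (convex_Icc a b).mul_sub_le_image_sub_of_le_deriv q.continuous.continuousOn
        q.differentiable.differentiableOn (fun x hx => by
          rw [q.deriv]; exact hq' x (interior_subset hx))
    obtain ⟨c, hc, hcl, hcr⟩ : ∃ c ∈ Set.Icc a b, (a < c → q.eval c ≤ 0) ∧
        (c < b → 0 ≤ q.eval c) := by
      by_cases h1 : 0 ≤ q.eval a
      · exact ⟨a, ⟨le_rfl, hab⟩, fun h => absurd h (lt_irrefl _), fun _ => h1⟩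
      by_cases h2 : q.eval b ≤ 0
      · exact ⟨b, ⟨hab, le_rfl⟩, fun _ => h2, fun h => absurd h (lt_irrefl _)⟩
      obtain ⟨c, hc, h0⟩ := intermediate_value_Icc hab q.continuous.continuousOn
        ⟨(not_le.1 h1).le, (not_le.1 h2).le⟩
      exact ⟨c, hc, fun _ => h0.le, fun _ => h0.ge⟩
    have hscale : (d ^ (m + 1 + 1))⁻¹ * d = (d ^ (m + 1))⁻¹ := by
      field_simp
      ring
    have hLpos : 0 < (d ^ (m + 1 + 1))⁻¹ := by positivity
    have hcd : m = 0 → ∀ x ∈ Set.Icc a b, 0 ≤ p.derivative.derivative.eval x := by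
      rintro rfl x hx
      exact hLpos.le.trans (hq' x hx)
    have hleft : ‖∫ x in a..max a (c - d), eC (p.eval x)‖ ≤ C * d := by
      rcases le_total (c - d) a with hca | hca
      · rw [max_eq_left hca]
        simpa using mul_nonneg hC hd.le
      rw [max_eq_right hca, ← norm_integral_eC_neg]
      have hsub : ∀ x ∈ Set.Icc a (c - d), x ∈ Set.Icc a b := fun x hx =>
        ⟨hx.1, by linarith [hx.2, hc.2]⟩
      refine ih (-p) a (c - d) d hca hd (fun x hx => ?_) fun hm => Or.inr fun x hx => ?_
      · have h1 := hgrow x (hsub x hx) c hc (by linarith [hx.2])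
        have h2 := hcl (by linarith)
        have h3 : (d ^ (m + 1 + 1))⁻¹ * d ≤ (d ^ (m + 1 + 1))⁻¹ * (c - x) :=
          mul_le_mul_of_nonneg_left (by linarith [hx.2]) hLpos.le
        rw [Polynomial.iterate_derivative_neg, Polynomial.eval_neg, ← hq]
        linarith
      · simpa using hcd hm x (hsub x hx)
    have hright : ‖∫ x in min b (c + d)..b, eC (p.eval x)‖ ≤ C * d := by
      rcases le_total b (c + d) with hca | hca
      · rw [min_eq_left hca]
        simpa using mul_nonneg hC hd.le
      rw [min_eq_right hca]
      have hsub : ∀ x ∈ Set.Icc (c + d) b, x ∈ Set.Icc a b := fun x hx =>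
        ⟨by linarith [hx.1, hc.1], hx.2⟩
      refine ih p (c + d) b d hca hd (fun x hx => ?_) fun hm => Or.inl fun x hx =>
        hcd hm x (hsub x hx)
      have h1 := hgrow c hc x (hsub x hx) (by linarith [hx.1])
      have h2 := hcr (by linarith)
      have h3 : (d ^ (m + 1 + 1))⁻¹ * d ≤ (d ^ (m + 1 + 1))⁻¹ * (x - c) :=
        mul_le_mul_of_nonneg_left (by linarith [hx.1]) hLpos.le
      rw [← hq]
      linarith
    have hmid : ‖∫ x in max a (c - d)..min b (c + d), eC (p.eval x)‖ ≤ 2 * d := by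
      refine (norm_integral_eC_le_abs_sub _ _ _).trans ?_
      have h1 := le_max_right a (c - d)
      have h2 := min_le_right b (c + d)
      have h3 : max a (c - d) ≤ c := max_le hc.1 (by linarith)
      have h4 : c ≤ min b (c + d) := le_min hc.2 (by linarith)
      rw [abs_of_nonneg (by linarith)]
      linarith
    have hint : ∀ u v : ℝ, IntervalIntegrable (fun x => eC (p.eval x)) volume u v :=
      fun u v => (continuous_eC.comp p.continuous).intervalIntegrable _ _
    rw [← intervalIntegral.integral_add_adjacent_intervals (hint a (max a (c - d))) (hint _ b),
      ← intervalIntegral.integral_add_adjacent_intervals (hint _ (min b (c + d))) (hint _ b)]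
    refine (norm_add_le _ _).trans ((add_le_add hleft ((norm_add_le _ _).trans
      (add_le_add hmid hright))).trans (le_of_eq ?_))
    ring

lemma abs_eval_le_of_abs_coeff_le (q : Polynomial ℝ) {N : ℕ} {B x : ℝ} (hN : q.natDegree < N)
    (hB : ∀ i, |q.coeff i| ≤ B) (hx : x ∈ Set.Icc (0 : ℝ) 1) : |q.eval x| ≤ N * B := by
  rw [Polynomial.eval_eq_sum_range' hN]
  refine (Finset.abs_sum_le_sum_abs _ _).trans ?_
  refine (Finset.sum_le_card_nsmul _ _ B fun i _ => ?_).trans (by simp)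
  rw [abs_mul, abs_pow, abs_of_nonneg hx.1]
  calc |q.coeff i| * x ^ i ≤ |q.coeff i| * 1 := by
        gcongr
        exact pow_le_one₀ hx.1 hx.2
    _ ≤ B := by simpa using hB i

/-- If the coefficient of index `m` dominates, after weighting by powers of a large number, then
the higher coefficients of the derivatives are small in comparison. -/
lemma abs_coeff_iterate_derivative_le (p : Polynomial ℝ) {K m n i : ℕ} (hK : 1 ≤ K)
    (hp : p.natDegree ≤ K)
    (hm : ∀ j ∈ Finset.Icc 1 K, |p.coeff j| * (2 * K * K.factorial : ℝ) ^ j ≤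
      |p.coeff m| * (2 * K * K.factorial : ℝ) ^ m) (hmi : m < i + n) :
    |(Polynomial.derivative^[n] p).coeff i| ≤ |p.coeff m| / (2 * K) := by
  have hK' : (1 : ℝ) ≤ K := by exact_mod_cast hK
  have hf : (1 : ℝ) ≤ K.factorial := by exact_mod_cast K.factorial_pos
  rw [Polynomial.coeff_iterate_derivative, nsmul_eq_mul, abs_mul, Nat.abs_cast]
  by_cases hiK : K < i + n
  · rw [Polynomial.coeff_eq_zero_of_natDegree_lt (hp.trans_lt hiK)]
    simp only [abs_zero, mul_zero]
    positivity
  set R : ℝ := 2 * K * K.factorial with hR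
  have hR1 : 1 ≤ R := by nlinarith
  have hd : ((i + n).descFactorial n : ℝ) ≤ K.factorial := by
    exact_mod_cast (Nat.le_of_dvd (Nat.factorial_pos _)
      ⟨_, ((mul_comm _ _).trans (Nat.factorial_mul_descFactorial (Nat.le_add_left n i))).symm⟩).trans
      (Nat.factorial_le (not_lt.1 hiK))
  have h1 := hm (i + n) (Finset.mem_Icc.2 ⟨by omega, not_lt.1 hiK⟩)
  have h2 : |p.coeff (i + n)| * R ≤ |p.coeff m| := by
    have h3 : R ^ m * R ≤ R ^ (i + n) := by
      rw [← pow_succ]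
      exact pow_le_pow_right₀ hR1 hmi
    have h4 : 0 < R ^ m := by positivity
    refine le_of_mul_le_mul_right ?_ h4
    calc |p.coeff (i + n)| * R * R ^ m = |p.coeff (i + n)| * (R ^ m * R) := by ring
      _ ≤ |p.coeff (i + n)| * R ^ (i + n) := by gcongr
      _ ≤ _ := h1
  rw [le_div_iff₀ (by positivity)]
  calc _ ≤ (K.factorial : ℝ) * |p.coeff (i + n)| * (2 * K) := by gcongr
    _ = |p.coeff (i + n)| * R := by rw [hR]; ring
    _ ≤ _ := h2

/-- Oscillatory integral over `[0, 1]` in terms of a dominating coefficient. -/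
lemma exists_norm_integral_eC_le_dominant (K : ℕ) (hK : 1 ≤ K) : ∃ C : ℝ, 1 ≤ C ∧
    ∀ p : Polynomial ℝ, p.natDegree ≤ K → ∀ m ∈ Finset.Icc 1 K, 0 < p.coeff m →
      (∀ j ∈ Finset.Icc 1 K, |p.coeff j| * (2 * K * K.factorial : ℝ) ^ j ≤
        |p.coeff m| * (2 * K * K.factorial : ℝ) ^ m) →
      ‖∫ x in (0 : ℝ)..1, eC (p.eval x)‖ ≤ C * (p.coeff m / 2) ^ (-(1 / m : ℝ)) := by
  choose C hC hCp using exists_norm_integral_eC_le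
  have hK' : (1 : ℝ) ≤ K := by exact_mod_cast hK
  refine ⟨4 + ∑ i ∈ range K, C i, ?_, fun p hp m hmK ha hm => ?_⟩
  · linarith [Finset.sum_nonneg fun i (_ : i ∈ range K) => hC i]
  obtain ⟨n, rfl⟩ : ∃ n, m = n + 1 := ⟨m - 1, by have := (Finset.mem_Icc.1 hmK).1; omega⟩
  have hnK : n < K := by have := (Finset.mem_Icc.1 hmK).2; omega
  set a := p.coeff (n + 1) with ha'
  have hsum : C n ≤ ∑ i ∈ range K, C i :=
    Finset.single_le_sum (fun i _ => hC i) (Finset.mem_range.2 hnK)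
  have hsum0 : 0 ≤ ∑ i ∈ range K, C i := (hC n).trans hsum
  have hlow : ∀ x ∈ Set.Icc (0 : ℝ) 1, a / 2 ≤ (Polynomial.derivative^[n + 1] p).eval x := by
    intro x hx
    set q := Polynomial.derivative^[n + 1] p with hq
    have h0 : a ≤ q.coeff 0 := by
      rw [hq, Polynomial.coeff_iterate_derivative, zero_add, nsmul_eq_mul, ← ha',
        Nat.descFactorial_self]
      have : (1 : ℝ) ≤ (n + 1).factorial := by exact_mod_cast (n + 1).factorial_pos
      nlinarith
    have h1 : |q.divX.eval x| ≤ K * (a / (2 * K)) := by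
      refine abs_eval_le_of_abs_coeff_le _ ?_ (fun i => ?_) hx
      · rw [Polynomial.natDegree_divX_eq_natDegree_tsub_one]
        have : q.natDegree ≤ _ := Polynomial.natDegree_iterate_derivative p (n + 1)
        omega
      · rw [Polynomial.coeff_divX]
        have := abs_coeff_iterate_derivative_le p (n := n + 1) (i := i + 1) hK hp hm (by omega)
        rwa [← ha', abs_of_pos ha] at this
    have h2 : (K : ℝ) * (a / (2 * K)) = a / 2 := by field_simp
    rw [h2] at h1
    have h3 : q.eval x = q.divX.eval x * x + q.coeff 0 := by
      conv_lhs => rw [← Polynomial.divX_mul_X_add q]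
      simp
    have h4 : |q.divX.eval x * x| ≤ a / 2 := by
      rw [abs_mul, abs_of_nonneg hx.1]
      nlinarith [abs_nonneg (q.divX.eval x), hx.1, hx.2]
    have := neg_abs_le (q.divX.eval x * x)
    linarith
  rcases Nat.eq_zero_or_pos n with rfl | hn
  · have hb : ∀ x ∈ Set.Icc (0 : ℝ) 1, |p.derivative.derivative.eval x| ≤ a := by
      intro x hx
      refine (abs_eval_le_of_abs_coeff_le (N := 2 * K) (B := a / (2 * K)) _ ?_ (fun i => ?_)
        hx).trans (le_of_eq ?_)
      · have := Polynomial.natDegree_iterate_derivative p 2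
        simp only [Function.iterate_succ, Function.iterate_zero, Function.comp, id] at this
        omega
      · have := abs_coeff_iterate_derivative_le p (n := 2) (i := i) hK hp hm (by omega)
        rwa [← ha', abs_of_pos ha] at this
      · push_cast
        field_simp
    have hV : ∫ x in (0 : ℝ)..1, |p.derivative.derivative.eval x| / p.derivative.eval x ^ 2 ≤
        4 / a := by
      rw [show 4 / a = 4 / a * |(1 : ℝ) - 0| by simp]
      refine (Real.le_norm_self _).trans (intervalIntegral.norm_integral_le_of_norm_le_const
        fun x hx => ?_)
      rw [Set.uIoc_of_le zero_le_one] at hx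
      have hx' : x ∈ Set.Icc (0 : ℝ) 1 := ⟨hx.1.le, hx.2⟩
      have h1 : a / 2 ≤ p.derivative.eval x := hlow x hx'
      rw [Real.norm_eq_abs, abs_div, abs_abs, abs_pow, sq_abs]
      calc _ ≤ a / (a / 2) ^ 2 := by
            gcongr
            exact hb x hx'
        _ = 4 / a := by field_simp; norm_num
    refine (norm_integral_eC_le_of_le_derivative p zero_le_one (l := a / 2) (by positivity)
      hlow hV).trans ?_
    have e : (a / 2) ^ (-(1 / ((0 + 1 : ℕ) : ℝ))) = 2 / a := by
      simp [Real.rpow_neg_one]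
    rw [e]
    have e2 : 2 / (a / 2) + 4 / a = 4 * (2 / a) := by field_simp; norm_num
    rw [e2]
    gcongr
    linarith
  · have hd : 0 < (a / 2) ^ (-(1 / ((n + 1 : ℕ) : ℝ))) := by positivity
    refine (hCp n p 0 1 _ zero_le_one hd (fun x hx => ?_) fun h => absurd h hn.ne').trans ?_
    · refine le_trans (le_of_eq ?_) (hlow x hx)
      rw [← Real.rpow_natCast, ← Real.rpow_mul (by positivity), ← Real.rpow_neg (by positivity)]
      have : ((n + 1 : ℕ) : ℝ) ≠ 0 := by positivity
      rw [show -(-(1 / ((n + 1 : ℕ) : ℝ)) * ((n + 1 : ℕ) : ℝ)) = 1 by field_simp, Real.rpow_one]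
    · gcongr
      linarith

/-- Bound for the oscillatory integral of a polynomial phase of degree at most `K` in terms of any
of its nonconstant coefficients. -/
lemma exists_norm_integral_eC_le_coeff (K : ℕ) (hK : 1 ≤ K) : ∃ A : ℝ, 0 < A ∧
    ∀ p : Polynomial ℝ, p.natDegree ≤ K → ∀ j ∈ Finset.Icc 1 K,
      ‖∫ x in (0 : ℝ)..1, eC (p.eval x)‖ ≤ A * (1 + |p.coeff j|) ^ (-(1 / K : ℝ)) := by
  obtain ⟨C, hC, hCp⟩ := exists_norm_integral_eC_le_dominant K hK
  have hK' : (1 : ℝ) ≤ K := by exact_mod_cast hK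
  have hf : (1 : ℝ) ≤ K.factorial := by exact_mod_cast K.factorial_pos
  set R : ℝ := 2 * K * K.factorial with hR
  have hR1 : 1 ≤ R := by nlinarith
  refine ⟨C * (3 * R ^ K) ^ (1 / K : ℝ), by positivity, fun p hp j hj => ?_⟩
  obtain ⟨m, hmK, hm⟩ := Finset.exists_max_image (Finset.Icc 1 K) (fun j => |p.coeff j| * R ^ j)
    ⟨1, Finset.mem_Icc.2 ⟨le_rfl, hK⟩⟩
  obtain ⟨hm1, hmK'⟩ := Finset.mem_Icc.1 hmK
  have hm1' : (1 : ℝ) ≤ m := by exact_mod_cast hm1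
  set M := max (|p.coeff m| / 2) 1 with hM
  have hM1 : 1 ≤ M := le_max_right _ _
  have hmain : ‖∫ x in (0 : ℝ)..1, eC (p.eval x)‖ ≤ C * M ^ (-(1 / K : ℝ)) := by
    rcases le_total (|p.coeff m| / 2) 1 with h | h
    · rw [hM, max_eq_right h, Real.one_rpow, mul_one]
      refine (norm_integral_eC_le_abs_sub _ _ _).trans (le_trans (by simp) hC)
    rw [hM, max_eq_left h]
    have hexp : (|p.coeff m| / 2) ^ (-(1 / m : ℝ)) ≤ (|p.coeff m| / 2) ^ (-(1 / K : ℝ)) := by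
      refine Real.rpow_le_rpow_of_exponent_le h (neg_le_neg ?_)
      have : (m : ℝ) ≤ K := by exact_mod_cast hmK'
      gcongr
    refine le_trans ?_ (mul_le_mul_of_nonneg_left hexp (by linarith))
    rcases le_or_gt (p.coeff m) 0 with h0 | h0
    · have hne : 0 < (-p).coeff m := by
        rw [Polynomial.coeff_neg]
        rcases h0.lt_or_eq with h0 | h0
        · linarith
        · norm_num [h0] at h
      have := hCp (-p) (by rwa [Polynomial.natDegree_neg]) m hmK hne (by simpa using hm)
      rwa [norm_integral_eC_neg, Polynomial.coeff_neg, ← abs_of_nonpos h0] at this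
    · have := hCp p hp m hmK h0 hm
      rwa [← abs_of_pos h0] at this
  refine hmain.trans ?_
  have hle : 1 + |p.coeff j| ≤ 3 * R ^ K * M := by
    have h1 : |p.coeff j| ≤ |p.coeff j| * R ^ j :=
      le_mul_of_one_le_right (abs_nonneg _) (one_le_pow₀ hR1)
    have h2 := hm j hj
    have h3 : |p.coeff m| * R ^ m ≤ 2 * M * R ^ K := by
      gcongr
      linarith [le_max_left (|p.coeff m| / 2) 1]
    have h4 : 1 ≤ R ^ K := one_le_pow₀ hR1
    nlinarith
  have hpow := Real.rpow_le_rpow_of_nonpos (z := -(1 / K : ℝ)) (by positivity) hle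
    (by have : (0 : ℝ) ≤ 1 / K := by positivity
        linarith)
  rw [Real.mul_rpow (by positivity) (by positivity), Real.rpow_neg (by positivity),
    inv_mul_le_iff₀ (by positivity)] at hpow
  rw [mul_assoc]
  gcongr

/-- A power-saving estimate for truncated integrals of a function which is dominated by products
of decaying functions in linear coordinates. -/
lemma exists_limit_setIntegral_box {ι S : Type*} [Fintype ι] [Fintype S]
    (T : S → (ι → ℝ) →ₗ[ℝ] (ι → ℝ)) (hT : ∀ σ, Function.Injective (T σ))
    {F : (ι → ℝ) → ℂ} (hF : Continuous F) {ε C : ℝ} (hε : 0 < ε) (hC : 0 ≤ C)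
    (hbound : ∀ x, ∃ σ, ‖F x‖ ≤ C * ∏ i, (1 + |T σ x i|) ^ (-(1 + 2 * ε))) :
    ∃ (L : ℂ) (C' : ℝ), ∀ X : ℝ, 1 ≤ X →
      ‖L - ∫ x in Set.univ.pi fun _ : ι => Set.Icc (-X) X, F x‖ ≤ C' * X ^ (-ε) := by
  set g : (ι → ℝ) → ℝ := fun y => ∏ i, (1 + |y i|) ^ (-(1 + ε)) with hg
  have hg0 : ∀ y, 0 ≤ g y := fun y => Finset.prod_nonneg fun i _ => by positivity
  have hgI : Integrable g := by
    refine Integrable.fintype_prod (f := fun _ : ι => fun y : ℝ => (1 + |y|) ^ (-(1 + ε)))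
      fun i => ?_
    exact integrable_one_add_norm (E := ℝ) (by simp [hε])
  have hgT : ∀ σ, Integrable fun x => g (T σ x) := by
    intro σ
    have hdet : LinearMap.det (T σ) ≠ 0 := by
      rw [show T σ = (LinearEquiv.ofInjectiveEndo (T σ) (hT σ) : (ι → ℝ) →ₗ[ℝ] (ι → ℝ)) by
        ext; simp]
      exact (LinearEquiv.isUnit_det' _).ne_zero
    have hmap := Measure.map_linearMap_addHaar_eq_smul_addHaar (volume : Measure (ι → ℝ)) hdet
    have h1 : Integrable g (Measure.map (T σ) volume) := by
      rw [hmap]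
      exact hgI.smul_measure ENNReal.ofReal_ne_top
    exact h1.comp_measurable (T σ).continuous_of_finiteDimensional.measurable
  have hM : ∀ σ, ∃ M : ℝ, 0 ≤ M ∧ ∀ x, ‖x‖ ≤ M * ‖T σ x‖ := by
    intro σ
    refine ⟨‖((LinearEquiv.ofInjectiveEndo (T σ) (hT σ)).symm.toContinuousLinearEquiv :
      (ι → ℝ) →L[ℝ] (ι → ℝ))‖, norm_nonneg _, fun x => ?_⟩
    have := ((LinearEquiv.ofInjectiveEndo (T σ) (hT σ)).symm.toContinuousLinearEquiv :
      (ι → ℝ) →L[ℝ] (ι → ℝ)).le_opNorm (T σ x)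
    refine le_trans (le_of_eq ?_) this
    congr 1
    exact ((LinearEquiv.ofInjectiveEndo (T σ) (hT σ)).symm_apply_apply x).symm
  choose M hM0 hM using hM
  set N := 1 + ∑ σ, M σ with hN
  have hMN : ∀ σ, M σ ≤ N := fun σ => by
    have := Finset.single_le_sum (fun i _ => hM0 i) (Finset.mem_univ σ)
    linarith
  have hN1 : 1 ≤ N := by
    have := Finset.sum_nonneg fun i (_ : i ∈ Finset.univ) => hM0 i
    linarith
  have hprod : ∀ y : ι → ℝ, 1 + ‖y‖ ≤ ∏ i, (1 + |y i|) := by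
    intro y
    have h1 : ∀ i, 1 + |y i| ≤ ∏ i, (1 + |y i|) := fun i => by
      simpa using Finset.prod_le_prod_of_subset_of_one_le (f := fun i => 1 + |y i|)
        (Finset.subset_univ {i}) (fun j _ => by positivity) (fun j _ _ => by simp)
    have h0 : 1 ≤ ∏ i, (1 + |y i|) := Finset.one_le_prod fun i _ => by simp
    have : ‖y‖ ≤ ∏ i, (1 + |y i|) - 1 :=
      (pi_norm_le_iff_of_nonneg (by linarith)).2 fun i => by
        rw [Real.norm_eq_abs]
        linarith [h1 i]
    linarith
  set H : (ι → ℝ) → ℝ := fun x => ∑ σ, g (T σ x) with hH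
  have hHI : Integrable H := integrable_finsetSum _ fun σ _ => hgT σ
  have hH0 : ∀ x, 0 ≤ H x := fun x => Finset.sum_nonneg fun σ _ => hg0 _
  have hFH : ∀ x, ‖F x‖ ≤ C * N ^ ε * (1 + ‖x‖) ^ (-ε) * H x := by
    intro x
    obtain ⟨σ, hσ⟩ := hbound x
    refine hσ.trans ?_
    have h1 : ∏ i, (1 + |T σ x i|) ^ (-(1 + 2 * ε)) =
        (∏ i, (1 + |T σ x i|)) ^ (-ε) * g (T σ x) := by
      rw [← Real.finsetProd_rpow _ _ (fun i _ => by positivity), hg, ← Finset.prod_mul_distrib]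
      refine Finset.prod_congr rfl fun i _ => ?_
      rw [← Real.rpow_add (by positivity)]
      ring_nf
    have h2 : 1 + ‖x‖ ≤ N * ∏ i, (1 + |T σ x i|) := by
      have h3 := hM σ x
      have h4 := hprod (T σ x)
      have h5 := mul_le_mul_of_nonneg_right (hMN σ) (norm_nonneg (T σ x))
      nlinarith
    have hP : 0 < ∏ i, (1 + |T σ x i|) := Finset.prod_pos fun i _ => by positivity
    have h3 : (∏ i, (1 + |T σ x i|)) ^ (-ε) ≤ N ^ ε * (1 + ‖x‖) ^ (-ε) := by
      have := Real.rpow_le_rpow_of_nonpos (z := -ε) (by positivity) h2 (by linarith)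
      rw [Real.mul_rpow (by positivity) hP.le, Real.rpow_neg (by positivity),
        inv_mul_le_iff₀ (by positivity)] at this
      exact this
    have h4 : g (T σ x) ≤ H x :=
      Finset.single_le_sum (f := fun σ => g (T σ x)) (fun i _ => hg0 _) (Finset.mem_univ σ)
    rw [h1]
    calc _ ≤ C * ((N ^ ε * (1 + ‖x‖) ^ (-ε)) * H x) := by
          gcongr
      _ = _ := by ring
  have hFI : Integrable F := by
    refine (hHI.const_mul (C * N ^ ε)).mono' hF.aestronglyMeasurable
      (Filter.Eventually.of_forall fun x => (hFH x).trans ?_)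
    have : (1 + ‖x‖) ^ (-ε) ≤ 1 :=
      Real.rpow_le_one_of_one_le_of_nonpos (by simp) (by linarith)
    have h0 := hH0 x
    exact mul_le_mul_of_nonneg_right (mul_le_of_le_one_right (by positivity) this) h0
  refine ⟨∫ x, F x, C * N ^ ε * ∫ x, H x, fun X hX => ?_⟩
  set B : Set (ι → ℝ) := Set.univ.pi fun _ : ι => Set.Icc (-X) X with hB
  have hBm : MeasurableSet B := MeasurableSet.univ_pi fun _ => measurableSet_Icc
  rw [← integral_add_compl hBm hFI, add_sub_cancel_left]
  have hle : ∀ x ∈ Bᶜ, ‖F x‖ ≤ C * N ^ ε * X ^ (-ε) * H x := by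
    intro x hx
    refine (hFH x).trans ?_
    have hxX : X ≤ 1 + ‖x‖ := by
      by_contra hcon
      refine hx fun i _ => abs_le.1 ?_
      have := norm_le_pi_norm x i
      rw [Real.norm_eq_abs] at this
      linarith
    have := Real.rpow_le_rpow_of_nonpos (z := -ε) (by positivity) hxX (by linarith)
    have h0 := hH0 x
    gcongr
  calc ‖∫ x in Bᶜ, F x‖ ≤ ∫ x in Bᶜ, C * N ^ ε * X ^ (-ε) * H x :=
        norm_integral_le_of_norm_le (hHI.const_mul _).integrableOn
          ((ae_restrict_iff' hBm.compl).2 (Filter.Eventually.of_forall hle))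
    _ = C * N ^ ε * X ^ (-ε) * ∫ x in Bᶜ, H x := integral_const_mul _ _
    _ ≤ C * N ^ ε * X ^ (-ε) * ∫ x, H x := by
        refine mul_le_mul_of_nonneg_left ?_ (by positivity)
        exact setIntegral_le_integral hHI (Filter.Eventually.of_forall hH0)
    _ = _ := by ring

/-- A product of numbers in `[0, 1]` is bounded by a product of powers of selected factors. -/
lemma exists_injective_prod_le_prod_pow {B J : Type*} [Fintype B] [Fintype J] (n : B → ℕ)
    (hn : ∀ b, 0 < n b) (hcard : ∑ b, n b ≤ Fintype.card J) (f : J → ℝ) (h0 : ∀ j, 0 ≤ f j)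
    (h1 : ∀ j, f j ≤ 1) :
    ∃ σ : B → J, Function.Injective σ ∧ ∏ j, f j ≤ ∏ b, f (σ b) ^ n b := by
  obtain ⟨e⟩ : Nonempty ((Σ b, Fin (n b)) ↪ J) :=
    Function.Embedding.nonempty_of_card_le (by simpa using hcard)
  have hmax : ∀ b, ∃ i : Fin (n b), ∀ i', f (e ⟨b, i'⟩) ≤ f (e ⟨b, i⟩) := fun b =>
    haveI : Nonempty (Fin (n b)) := ⟨⟨0, hn b⟩⟩
    Finite.exists_max fun i => f (e ⟨b, i⟩)
  choose i hi using hmax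
  refine ⟨fun b => e ⟨b, i b⟩, fun b b' h => ?_, ?_⟩
  · exact congrArg Sigma.fst (e.injective h)
  calc ∏ j, f j ≤ ∏ j ∈ Finset.univ.map e, f j :=
        Finset.prod_le_prod_of_subset_of_le_one (Finset.subset_univ _) (fun j _ => h0 j)
          fun j _ _ => h1 j
    _ = ∏ b, ∏ i', f (e ⟨b, i'⟩) := by rw [Finset.prod_map, Fintype.prod_sigma]
    _ ≤ ∏ b, ∏ _i' : Fin (n b), f (e ⟨b, i b⟩) :=
        Finset.prod_le_prod (fun b _ => Finset.prod_nonneg fun _ _ => h0 _) fun b _ =>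
          Finset.prod_le_prod (fun _ _ => h0 _) fun i' _ => hi b i'
    _ = _ := by simp

lemma lt_card_filter_lt_iff {t : ℕ} {μ : Fin t → ℕ} (hμ : Antitone μ) (b : ℕ) (l : Fin t) :
    (l : ℕ) < #{l : Fin t | b < μ l} ↔ b < μ l := by
  constructor
  · intro h
    by_contra hb
    have hsub : ({l : Fin t | b < μ l} : Finset (Fin t)) ⊆ Finset.Iio l := by
      intro l' hl'
      rw [Finset.mem_Iio]
      by_contra hle
      exact hb ((Finset.mem_filter.1 hl').2.trans_le (hμ (not_lt.1 hle)))
    have := Finset.card_le_card hsub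
    rw [Fin.card_Iio] at this
    omega
  · intro h
    have hsub : Finset.Iic l ⊆ ({l : Fin t | b < μ l} : Finset (Fin t)) := fun l' hl' =>
      Finset.mem_filter.2 ⟨Finset.mem_univ _, h.trans_le (hμ (Finset.mem_Iic.1 hl'))⟩
    have := Finset.card_le_card hsub
    rw [Fin.card_Iic] at this
    omega

lemma varpi_card_filter_lt {t : ℕ} (ν : Fin t → ℕ) {μ : Fin t → ℕ} (hμ : Antitone μ) (b : ℕ) :
    varpi t ν #{l : Fin t | b < μ l} = #{p : KIdx t ν | b < μ p.1} := by
  rw [varpi, Finset.card_filter fun p : KIdx t ν => b < μ p.1, Fintype.sum_sigma]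
  refine Finset.sum_congr rfl fun l _ => ?_
  by_cases h : b < μ l <;> simp [lt_card_filter_lt_iff hμ, h]

lemma card_filter_lt_mem_Icc {t : ℕ} {μ : Fin t → ℕ} (h0 : 0 < t) (b : Fin (μ ⟨0, h0⟩)) :
    #{l : Fin t | (b : ℕ) < μ l} ∈ Finset.Icc 1 t := by
  refine Finset.mem_Icc.2 ⟨Finset.card_pos.2 ⟨⟨0, h0⟩, by simp⟩, ?_⟩
  simpa using Finset.card_filter_le (Finset.univ : Finset (Fin t)) fun l => (b : ℕ) < μ l

lemma sum_card_filter_lt_le {t : ℕ} {μ : Fin t → ℕ} (h0 : 0 < t) (hμ : Antitone μ) (u : ℕ → ℕ) :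
    ∑ b : Fin (μ ⟨0, h0⟩), u #{l : Fin t | (b : ℕ) < μ l} ≤
      ∑ h ∈ Finset.Icc 1 t, (mu1 t μ h - mu1 t μ (h + 1)) * u h := by
  rw [← Finset.sum_fiberwise_of_maps_to (g := fun b : Fin (μ ⟨0, h0⟩) =>
    #{l : Fin t | (b : ℕ) < μ l}) fun b _ => card_filter_lt_mem_Icc h0 b]
  refine Finset.sum_le_sum fun h hh => ?_
  rw [Finset.sum_congr rfl (g := fun _ => u h) fun b hb => by rw [(Finset.mem_filter.1 hb).2],
    Finset.sum_const, smul_eq_mul]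
  refine Nat.mul_le_mul_right _ ?_
  rw [← Nat.card_Ico, ← Finset.card_map Fin.valEmbedding]
  refine Finset.card_le_card fun m hm => ?_
  obtain ⟨b, hb, rfl⟩ := Finset.mem_map.1 hm
  have hbh := (Finset.mem_filter.1 hb).2
  obtain ⟨h1, h2⟩ := Finset.mem_Icc.1 hh
  simp only [Fin.valEmbedding_apply, Finset.mem_Ico]
  constructor
  · unfold mu1
    split_ifs with hc
    · by_contra hcon
      have := (lt_card_filter_lt_iff hμ b ⟨h + 1 - 1, by omega⟩).2 (not_le.1 hcon)
      rw [hbh] at this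
      simp at this
    · exact Nat.zero_le _
  · unfold mu1
    rw [dif_pos ⟨h1, h2⟩]
    refine (lt_card_filter_lt_iff hμ b ⟨h - 1, by omega⟩).1 ?_
    rw [hbh]
    simp only
    omega

/-- The linear coordinates `δ_{j,l,n} = Σ_{i ∈ 𝓘_{l,n}} c_{ij} β_i`, where `j = τ l m` depends on
the index `(l, n, m)`. -/
def deltaMap {t : ℕ} {ν μ : Fin t → ℕ} {s : ℕ} (c : EqIdx t ν μ → Fin s → ℤ)
    (τ : (l : Fin t) → Fin (μ l) → Fin s) :
    (EqIdx t ν μ → ℝ) →ₗ[ℝ] (EqIdx t ν μ → ℝ) :=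
  LinearMap.pi fun i => ∑ m : Fin (μ i.1),
    (c ⟨i.1, (i.2.1, m)⟩ (τ i.1 i.2.2) : ℝ) • LinearMap.proj ⟨i.1, (i.2.1, m)⟩

lemma deltaMap_apply {t : ℕ} {ν μ : Fin t → ℕ} {s : ℕ} (c : EqIdx t ν μ → Fin s → ℤ)
    (τ : (l : Fin t) → Fin (μ l) → Fin s) (β : EqIdx t ν μ → ℝ) (i : EqIdx t ν μ) :
    deltaMap c τ β i =
      ∑ m : Fin (μ i.1), (c ⟨i.1, (i.2.1, m)⟩ (τ i.1 i.2.2) : ℝ) * β ⟨i.1, (i.2.1, m)⟩ := by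
  simp [deltaMap]

lemma deltaMap_injective {t : ℕ} {ν μ : Fin t → ℕ} {s : ℕ} {c : EqIdx t ν μ → Fin s → ℤ}
    (hns : HighlyNonSingular t ν μ s c) {τ : (l : Fin t) → Fin (μ l) → Fin s}
    (hτ : ∀ l, Function.Injective (τ l)) : Function.Injective (deltaMap c τ) := by
  rw [injective_iff_map_eq_zero]
  intro β hβ
  ext ⟨l, n, m⟩
  have hdet := hns.2 l n (τ l) (hτ l)
  set A : Matrix (Fin (μ l)) (Fin (μ l)) ℤ := Matrix.of fun m m' => c ⟨l, (n, m)⟩ (τ l m')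
  have hA : (A.map (Int.castRingHom ℝ)).transpose.det ≠ 0 := by
    rw [Matrix.det_transpose, ← RingHom.mapMatrix_apply, ← RingHom.map_det]
    simpa using hdet
  have hv : (A.map (Int.castRingHom ℝ)).transpose.mulVec (fun m => β ⟨l, (n, m)⟩) = 0 := by
    ext m'
    have := congrFun hβ ⟨l, (n, m')⟩
    rw [deltaMap_apply] at this
    simpa [Matrix.mulVec, dotProduct, A] using this
  exact congrFun (Matrix.eq_zero_of_mulVec_eq_zero hA hv) m

lemma norm_vj_le_one (t : ℕ) (ν μ : Fin t → ℕ) (k : (l : Fin t) → Fin (ν l) → ℕ) (s : ℕ)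
    (c : EqIdx t ν μ → Fin s → ℤ) (β : EqIdx t ν μ → ℝ) (j : Fin s) :
    ‖vj t ν μ k s c 1 β j‖ ≤ 1 := by
  simpa [vj] using norm_integral_eC_le_abs_sub
    (fun z => ∑ i : EqIdx t ν μ, (c i j : ℝ) * β i * z ^ deg t ν μ k i) 0 1

lemma continuous_vj (t : ℕ) (ν μ : Fin t → ℕ) (k : (l : Fin t) → Fin (ν l) → ℕ) (s : ℕ)
    (c : EqIdx t ν μ → Fin s → ℤ) (P : ℝ) (j : Fin s) :
    Continuous fun β => vj t ν μ k s c P β j := by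
  unfold vj
  refine intervalIntegral.continuous_parametric_intervalIntegral_of_continuous' ?_ _ _
  exact continuous_eC.comp (by fun_prop)

lemma exists_norm_vj_le (t : ℕ) (ν μ : Fin t → ℕ) (k : (l : Fin t) → Fin (ν l) → ℕ)
    (hk : ∀ l n, 0 < k l n) (hkinj : Function.Injective fun p : KIdx t ν => k p.1 p.2)
    (hK : 1 ≤ kmax t ν k) (s : ℕ) (c : EqIdx t ν μ → Fin s → ℤ) :
    ∃ A : ℝ, 0 < A ∧ ∀ (β : EqIdx t ν μ → ℝ) (j : Fin s) (p : KIdx t ν),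
      ‖vj t ν μ k s c 1 β j‖ ≤ A * (1 + |∑ m : Fin (μ p.1),
        (c ⟨p.1, (p.2, m)⟩ j : ℝ) * β ⟨p.1, (p.2, m)⟩|) ^ (-(1 / kmax t ν k : ℝ)) := by
  obtain ⟨A, hA, h⟩ := exists_norm_integral_eC_le_coeff (kmax t ν k) hK
  have hle : ∀ p : KIdx t ν, k p.1 p.2 ≤ kmax t ν k := fun p =>
    Finset.le_sup (f := fun p : KIdx t ν => k p.1 p.2) (Finset.mem_univ p)
  refine ⟨A, hA, fun β j p => ?_⟩
  set q : Polynomial ℝ := ∑ i : EqIdx t ν μ,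
    Polynomial.C ((c i j : ℝ) * β i) * Polynomial.X ^ deg t ν μ k i with hq
  have hdeg : q.natDegree ≤ kmax t ν k :=
    Polynomial.natDegree_sum_le_of_forall_le _ _ fun i _ =>
      (Polynomial.natDegree_C_mul_X_pow_le _ _).trans (hle ⟨i.1, i.2.1⟩)
  have hcoeff : q.coeff (k p.1 p.2) =
      ∑ m : Fin (μ p.1), (c ⟨p.1, (p.2, m)⟩ j : ℝ) * β ⟨p.1, (p.2, m)⟩ := by
    rw [hq, Polynomial.finsetSum_coeff]
    simp only [Polynomial.coeff_C_mul_X_pow]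
    rw [← Finset.sum_filter]
    refine (Finset.sum_nbij (fun m : Fin (μ p.1) => (⟨p.1, (p.2, m)⟩ : EqIdx t ν μ))
      (fun m _ => Finset.mem_filter.2 ⟨Finset.mem_univ _, rfl⟩) (fun m _ m' _ hmm => by simpa using hmm) ?_
      fun m _ => rfl).symm
    rintro ⟨l, n, m⟩ hi
    have hi' : k p.1 p.2 = k l n := (Finset.mem_filter.1 (Finset.mem_coe.1 hi)).2
    obtain rfl : p = ⟨l, n⟩ := hkinj hi'
    exact ⟨m, by simp, rfl⟩
  have := h q hdeg (k p.1 p.2) (Finset.mem_Icc.2 ⟨hk _ _, hle p⟩)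
  rw [hcoeff] at this
  simpa [vj, hq, Polynomial.eval_finsetSum] using this

lemma prod_fin_ite_lt {a b : ℕ} (h : a ≤ b) (f : Fin b → ℝ) :
    ∏ i : Fin b, (if (i : ℕ) < a then f i else 1) = ∏ m : Fin a, f (Fin.castLE h m) := by
  rw [← Finset.prod_filter]
  refine (Finset.prod_nbij (Fin.castLE h) (fun m _ => by simp)
    (fun m _ m' _ hmm => Fin.castLE_injective h hmm) (fun i hi => ?_) fun m _ => rfl).symm
  exact ⟨⟨i, by simpa using hi⟩, by simp, by simp⟩

/-- Pointwise bound for the integrand of the singular integral by decaying products. -/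
lemma exists_norm_prod_vj_le (t : ℕ) (ν μ : Fin t → ℕ) (k : (l : Fin t) → Fin (ν l) → ℕ)
    (hgrp : GroupedDegrees t ν μ k) (s : ℕ) (c : EqIdx t ν μ → Fin s → ℤ) (u : ℕ → ℕ)
    (hu : ∀ h ∈ Finset.Icc 1 t, 0 < u h)
    (huk : ∀ h ∈ Finset.Icc 1 t,
      (kmax t ν k : ℝ) * (varpi t ν h : ℝ) < 2 * (u h : ℝ))
    (hs : 2 * ∑ h ∈ Finset.Icc 1 t, (mu1 t μ h - mu1 t μ (h + 1)) * u h < s) :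
    ∃ ε C : ℝ, 0 < ε ∧ 0 ≤ C ∧ ∀ β : EqIdx t ν μ → ℝ,
      ∃ τ : {τ : (l : Fin t) → Fin (μ l) → Fin s // ∀ l, Function.Injective (τ l)},
        ‖∏ j, vj t ν μ k s c 1 β j‖ ≤
          C * ∏ i, (1 + |deltaMap c τ β i|) ^ (-(1 + 2 * ε)) := by
  obtain ⟨ht, hν, -, hanti, hk, hkinj⟩ := hgrp
  have hμ : Antitone μ := hanti.antitone
  have hK : 1 ≤ kmax t ν k :=
    (hk ⟨0, ht⟩ ⟨0, hν _⟩).trans_le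
      (Finset.le_sup (f := fun p : KIdx t ν => k p.1 p.2) (Finset.mem_univ ⟨⟨0, ht⟩, ⟨0, hν _⟩⟩))
  obtain ⟨A, hA, hvj⟩ := exists_norm_vj_le t ν μ k hk hkinj hK s c
  set K := kmax t ν k
  have hK' : (1 : ℝ) ≤ K := by exact_mod_cast hK
  set D : ℕ := Fintype.card (KIdx t ν)
  set ε : ℝ := 1 / (2 * (1 + K * D)) with hε
  have hε0 : 0 < ε := by positivity
  set a : ℝ := K * (1 + 2 * ε) with ha
  have ha0 : 0 < a := by positivity
  refine ⟨ε, (A ^ a) ^ Fintype.card (EqIdx t ν μ), hε0, by positivity, fun β => ?_⟩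
  set H : Fin (μ ⟨0, ht⟩) → ℕ := fun b => #{l : Fin t | (b : ℕ) < μ l} with hH
  have hHmem : ∀ b, H b ∈ Finset.Icc 1 t := card_filter_lt_mem_Icc ht
  have hexp : ∀ b : Fin (μ ⟨0, ht⟩), a * #{p : KIdx t ν | (b : ℕ) < μ p.1} ≤ (2 * u (H b) : ℕ) := by
    intro b
    have h1 := huk _ (hHmem b)
    rw [hH, varpi_card_filter_lt ν hμ] at h1
    set N := #{p : KIdx t ν | (b : ℕ) < μ p.1}
    have h2 : K * N + 1 ≤ 2 * u (H b) := by exact_mod_cast h1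
    have h3 : (K * N + 1 : ℝ) ≤ (2 * u (H b) : ℕ) := by exact_mod_cast h2
    refine le_trans ?_ h3
    have hND : (N : ℝ) ≤ D := by exact_mod_cast Finset.card_le_univ _
    have h4 : 2 * ε * (1 + K * D) = 1 := by rw [hε]; field_simp
    have h5 : 2 * ε * (K * N) ≤ 2 * ε * (1 + K * D) := by
      gcongr
      nlinarith
    rw [ha]
    linarith
  obtain ⟨σ, hσ, hprod⟩ := exists_injective_prod_le_prod_pow (J := Fin s)
    (fun b => 2 * u (H b)) (fun b => by have := hu _ (hHmem b); omega)
    (by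
      rw [← Finset.mul_sum, Fintype.card_fin]
      exact (Nat.mul_le_mul_left 2 (sum_card_filter_lt_le ht hμ u)).trans hs.le)
    (fun j => ‖vj t ν μ k s c 1 β j‖) (fun j => norm_nonneg _)
    (norm_vj_le_one t ν μ k s c β)
  have hle : ∀ l, μ l ≤ μ ⟨0, ht⟩ := fun l => hμ (Fin.mk_le_of_le_val (Nat.zero_le _))
  refine ⟨⟨fun l m => σ (Fin.castLE (hle l) m), fun l =>
    hσ.comp (Fin.castLE_injective _)⟩, ?_⟩
  rw [norm_prod]
  refine hprod.trans ?_
  set W : KIdx t ν → Fin (μ ⟨0, ht⟩) → ℝ := fun p b =>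
    A ^ a * (1 + |∑ m : Fin (μ p.1), (c ⟨p.1, (p.2, m)⟩ (σ b) : ℝ) * β ⟨p.1, (p.2, m)⟩|) ^
      (-(1 + 2 * ε)) with hW
  have hfactor : ∀ b p, ‖vj t ν μ k s c 1 β (σ b)‖ ^ a ≤ W p b := by
    intro b p
    refine (Real.rpow_le_rpow (norm_nonneg _) (hvj β (σ b) p) ha0.le).trans (le_of_eq ?_)
    rw [Real.mul_rpow hA.le (by positivity), ← Real.rpow_mul (by positivity), hW]
    congr 2
    rw [ha]
    field_simp
  calc ∏ b, ‖vj t ν μ k s c 1 β (σ b)‖ ^ (2 * u (H b))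
      ≤ ∏ b : Fin (μ ⟨0, ht⟩), ∏ p : KIdx t ν, (if (b : ℕ) < μ p.1 then W p b else 1) := by
        refine Finset.prod_le_prod (fun b _ => by positivity) fun b _ => ?_
        rw [← Finset.prod_filter, ← Real.rpow_natCast]
        calc _ ≤ ‖vj t ν μ k s c 1 β (σ b)‖ ^ (a * #{p : KIdx t ν | (b : ℕ) < μ p.1}) :=
              Real.rpow_le_rpow_of_exponent_ge' (norm_nonneg _) (norm_vj_le_one ..)
                (by positivity) (hexp b)
          _ = ∏ p : KIdx t ν with (b : ℕ) < μ p.1, ‖vj t ν μ k s c 1 β (σ b)‖ ^ a := by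
              rw [Finset.prod_const, Real.rpow_mul (norm_nonneg _), Real.rpow_natCast]
          _ ≤ _ := Finset.prod_le_prod (fun p _ => by positivity) fun p _ => hfactor b p
    _ = ∏ p : KIdx t ν, ∏ m : Fin (μ p.1), W p (Fin.castLE (hle p.1) m) := by
        rw [Finset.prod_comm]
        exact Finset.prod_congr rfl fun p _ => prod_fin_ite_lt (hle p.1) (W p)
    _ = ∏ i : EqIdx t ν μ, W ⟨i.1, i.2.1⟩ (Fin.castLE (hle i.1) i.2.2) := by
        rw [Fintype.prod_sigma, Fintype.prod_sigma]
        refine Finset.prod_congr rfl fun l _ => ?_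
        rw [Fintype.prod_prod_type]
    _ = _ := by
        rw [hW, Finset.prod_mul_distrib, Finset.prod_const, Finset.card_univ]
        simp only [deltaMap_apply]

lemma vj_eq_mul_vj_one (t : ℕ) (ν μ : Fin t → ℕ) (k : (l : Fin t) → Fin (ν l) → ℕ) (s : ℕ)
    (c : EqIdx t ν μ → Fin s → ℤ) (P : ℝ) (β : EqIdx t ν μ → ℝ) (j : Fin s) :
    vj t ν μ k s c P β j = P * vj t ν μ k s c 1 (fun i => P ^ deg t ν μ k i * β i) j := by
  have := intervalIntegral.smul_integral_comp_mul_left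
    (fun z => eC (∑ i : EqIdx t ν μ, (c i j : ℝ) * β i * z ^ deg t ν μ k i)) P (a := 0) (b := 1)
  rw [mul_zero, mul_one] at this
  rw [vj, ← this, Complex.real_smul, vj]
  congr 3
  ext z
  congr 1
  refine Finset.sum_congr rfl fun i _ => ?_
  rw [mul_pow]
  ring

/-- Homogeneity of the truncated singular integral. -/
lemma singInt_eq_mul_setIntegral (t : ℕ) (ν μ : Fin t → ℕ) (k : (l : Fin t) → Fin (ν l) → ℕ)
    (s : ℕ) (c : EqIdx t ν μ → Fin s → ℤ) {P : ℝ} (hP : 0 < P) (X : ℝ) :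
    singInt t ν μ k s c P X = ((P ^ ((s : ℝ) - (Ktot t ν μ k : ℝ)) : ℝ) : ℂ) *
      ∫ β in Set.univ.pi fun _ : EqIdx t ν μ => Set.Icc (-X) X,
        ∏ j : Fin s, vj t ν μ k s c 1 β j := by
  set D : EqIdx t ν μ → ℝ := fun i => P ^ deg t ν μ k i with hD
  have hD0 : ∀ i, 0 < D i := fun i => by positivity
  have hdet : (Matrix.diagonal D).det = P ^ Ktot t ν μ k := by
    rw [Matrix.det_diagonal, hD, Finset.prod_pow_eq_pow_sum]
    rfl
  have hpos : 0 < (Matrix.diagonal D).det := by rw [hdet]; positivity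
  set T := Matrix.toLin' (Matrix.diagonal D) with hT
  have hTapp : ∀ β, T β = fun i => D i * β i := fun β => by
    ext i
    rw [hT, Matrix.toLin'_apply, Matrix.mulVec_diagonal]
  have hTinj : Function.Injective T := fun β β' h => by
    ext i
    have := congrFun h i
    rw [hTapp, hTapp] at this
    exact mul_left_cancel₀ (hD0 i).ne' this
  have hemb : MeasurableEmbedding T :=
    T.continuous_of_finiteDimensional.measurableEmbedding hTinj
  have hvol := Real.smul_map_diagonal_volume_pi hpos.ne'
  rw [← hT, hdet, abs_of_pos (by positivity)] at hvol
  have hbox : T ⁻¹' (Set.univ.pi fun _ : EqIdx t ν μ => Set.Icc (-X) X) =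
      Set.univ.pi fun i : EqIdx t ν μ => Set.Icc (-(X * P ^ (-(deg t ν μ k i : ℝ))))
        (X * P ^ (-(deg t ν μ k i : ℝ))) := by
    ext β
    simp only [Set.mem_preimage, Set.mem_univ_pi, Set.mem_Icc, ← abs_le, hTapp]
    refine forall_congr' fun i => ?_
    rw [Real.rpow_neg hP.le, Real.rpow_natCast, ← div_eq_mul_inv, le_div_iff₀ (hD0 i), abs_mul,
      abs_of_pos (hD0 i), mul_comm]
  conv_rhs => rw [← hvol]
  rw [Measure.restrict_smul, integral_smul_measure, hemb.setIntegral_map, hbox,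
    ENNReal.toReal_ofReal (by positivity), singInt, Complex.real_smul, ← mul_assoc,
    ← Complex.ofReal_mul, Real.rpow_sub hP, Real.rpow_natCast, Real.rpow_natCast,
    div_mul_cancel₀ _ (by positivity), ← integral_const_mul]
  congr 1
  ext β
  simp only [vj_eq_mul_vj_one t ν μ k s c P β, hTapp, Finset.prod_mul_distrib, Finset.prod_const,
    Finset.card_univ, Fintype.card_fin, Complex.ofReal_pow, hD]

/-- Lemma 4.2 of Brandes–Parsell, case `𝒜 = [1,P]`: if
`s > 2s₀` with `u_h > (k/2)ϖ_h`, then `𝔍 = lim_{X→∞} 𝔍(X)` exists and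
`𝔍 - 𝔍(X) ≪ P^{s-K} X^{-ν}` uniformly in `P ≥ 1`. -/
theorem statement13
    (t : ℕ) (ν μ : Fin t → ℕ) (k : (l : Fin t) → Fin (ν l) → ℕ)
    (hgrp : GroupedDegrees t ν μ k)
    (s : ℕ) (c : EqIdx t ν μ → Fin s → ℤ)
    (hns : HighlyNonSingular t ν μ s c)
    (u : ℕ → ℕ) (hu : ∀ h ∈ Finset.Icc 1 t, 0 < u h)
    (huk : ∀ h ∈ Finset.Icc 1 t,
      (kmax t ν k : ℝ) * (varpi t ν h : ℝ) < 2 * (u h : ℝ))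
    (hs : 2 * ∑ h ∈ Finset.Icc 1 t, (mu1 t μ h - mu1 t μ (h + 1)) * u h < s) :
    ∃ ν' : ℝ, 0 < ν' ∧ ∃ C : ℝ, ∀ P : ℝ, 1 ≤ P →
      ∃ L : ℂ, Filter.Tendsto (fun X : ℝ => singInt t ν μ k s c P X) Filter.atTop (nhds L) ∧
        ∀ X : ℝ, 1 ≤ X →
          ‖L - singInt t ν μ k s c P X‖ ≤
            C * P ^ ((s : ℝ) - (Ktot t ν μ k : ℝ)) * X ^ (-ν') := by
  obtain ⟨ε, C, hε, hC, hb⟩ := exists_norm_prod_vj_le t ν μ k hgrp s c u hu huk hs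
  obtain ⟨L, C', hL⟩ := exists_limit_setIntegral_box
    (fun τ : {τ : (l : Fin t) → Fin (μ l) → Fin s // ∀ l, Function.Injective (τ l)} =>
      deltaMap c τ.1) (fun τ => deltaMap_injective hns τ.2)
    (continuous_finsetProd _ fun j _ => continuous_vj t ν μ k s c 1 j) hε hC hb
  refine ⟨ε, hε, C', fun P hP => ?_⟩
  have hP0 : 0 < P := by linarith
  set Q : ℝ := P ^ ((s : ℝ) - (Ktot t ν μ k : ℝ))
  have hQ : 0 < Q := by positivity
  have hbound : ∀ X : ℝ, 1 ≤ X →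
      ‖(Q : ℂ) * L - singInt t ν μ k s c P X‖ ≤ C' * Q * X ^ (-ε) := by
    intro X hX
    rw [singInt_eq_mul_setIntegral t ν μ k s c hP0, ← mul_sub, norm_mul, Complex.norm_real,
      Real.norm_of_nonneg hQ.le]
    refine (mul_le_mul_of_nonneg_left (hL X hX) hQ.le).trans (le_of_eq ?_)
    ring
  refine ⟨Q * L, ?_, hbound⟩
  refine tendsto_iff_norm_sub_tendsto_zero.2 ?_
  have h0 : Tendsto (fun X : ℝ => C' * Q * X ^ (-ε)) atTop (nhds 0) := by
    simpa using (tendsto_rpow_neg_atTop hε).const_mul (C' * Q)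
  refine squeeze_zero' (Eventually.of_forall fun X => norm_nonneg _) ?_ h0
  filter_upwards [eventually_ge_atTop 1] with X hX
  rw [norm_sub_rev]
  exact hbound X hX

end
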